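/- Let n ≥ 1, let ν be an even Borel probability measure on S^{n−1}, fix α ≠ 0, and let F be a positive, continuous, α-homogeneous functional on convex bodies of ℝⁿ. For a positive continuous function q on S^{n−1}, set Γ(q) = F([q])^{−1/α} · exp(∫_{S^{n−1}} log q(u) dν(u)). Then inf{Γ(q) : q a positive, even, continuous function on S^{n−1}} = inf{exp(Φ_ν(Q)) : Q ∈ 𝒦ⁿ_e, F(Q) = 1}. -/

import Mathlib

open MeasureTheory Filter Topology
open scoped InnerProductSpace ENNReal Pointwise

noncomputable section

/-- The unit sphere `S^{n-1}` of `ℝⁿ`. -/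
def unitSphere (n : ℕ) : Set (EuclideanSpace ℝ (Fin n)) := Metric.sphere 0 1

/-- A convex body: compact, convex, with nonempty interior. -/
def IsConvexBody {n : ℕ} (K : Set (EuclideanSpace ℝ (Fin n))) : Prop :=
  IsCompact K ∧ Convex ℝ K ∧ (interior K).Nonempty

/-- The support function `h_K(u) = sup_{y ∈ K} ⟨y, u⟩`. -/
def suppFn {n : ℕ} (K : Set (EuclideanSpace ℝ (Fin n))) (u : EuclideanSpace ℝ (Fin n)) : ℝ :=
  sSup ((fun y => ⟪y, u⟫_ℝ) '' K)

/-- The Wulff shape of a function `f` on the sphere. -/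
def wulff {n : ℕ} (f : EuclideanSpace ℝ (Fin n) → ℝ) : Set (EuclideanSpace ℝ (Fin n)) :=
  {x | ∀ u ∈ unitSphere n, ⟪x, u⟫_ℝ ≤ f u}

/-- The log-functional `Φ_ν(Q) = ∫ log h_Q dν`. -/
def logFunc {n : ℕ} (ν : Measure (EuclideanSpace ℝ (Fin n)))
    (Q : Set (EuclideanSpace ℝ (Fin n))) : ℝ :=
  ∫ u, Real.log (suppFn Q u) ∂ν

section ConvexBodies

variable {n : ℕ} {K : Set (EuclideanSpace ℝ (Fin n))}

lemma inner_le_suppFn (hK : IsCompact K) {x : EuclideanSpace ℝ (Fin n)} (hx : x ∈ K)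
    (u : EuclideanSpace ℝ (Fin n)) : ⟪x, u⟫_ℝ ≤ suppFn K u :=
  le_csSup (hK.image (by fun_prop)).bddAbove ⟨x, hx, rfl⟩

lemma suppFn_le (hK : K.Nonempty) {u : EuclideanSpace ℝ (Fin n)} {c : ℝ}
    (h : ∀ x ∈ K, ⟪x, u⟫_ℝ ≤ c) : suppFn K u ≤ c :=
  csSup_le (hK.image _) (Set.forall_mem_image.2 h)

lemma continuous_suppFn (hK : IsCompact K) : Continuous (suppFn K) :=
  hK.continuous_sSup (f := fun u y => ⟪y, u⟫_ℝ)
    (continuous_snd.inner continuous_fst)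

lemma suppFn_neg (hK : K = -K) (u : EuclideanSpace ℝ (Fin n)) :
    suppFn K (-u) = suppFn K u := by
  unfold suppFn
  congr 1
  conv_lhs => rw [hK, ← Set.image_neg_eq_neg, Set.image_image]
  simp

lemma zero_mem_interior_of_symmetric (hK : IsConvexBody K) (hs : K = -K) : 0 ∈ interior K := by
  obtain ⟨-, hconv, x, hx⟩ := hK
  have hneg : -x ∈ interior K := by
    rw [hs]
    exact (((Homeomorph.neg _).preimage_interior K).subset (by simpa using hx))
  have := hconv.interior hx hneg (a := 1 / 2) (b := 1 / 2) (by norm_num) (by norm_num)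
    (by norm_num)
  simpa using this

lemma suppFn_pos (hK : IsCompact K) (h0 : 0 ∈ interior K) {u : EuclideanSpace ℝ (Fin n)}
    (hu : u ≠ 0) : 0 < suppFn K u := by
  obtain ⟨r, hr, hball⟩ := Metric.mem_nhds_iff.1 (mem_interior_iff_mem_nhds.1 h0)
  have hu' : 0 < ‖u‖ := norm_pos_iff.2 hu
  have hmem : (r / 2 / ‖u‖) • u ∈ K := by
    apply hball
    rw [mem_ball_zero_iff, norm_smul, Real.norm_of_nonneg (by positivity),
      div_mul_cancel₀ _ hu'.ne']
    linarith
  refine lt_of_lt_of_le ?_ (inner_le_suppFn hK hmem u)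
  rw [real_inner_smul_left, real_inner_self_eq_norm_sq]
  positivity

lemma ne_zero_of_mem_unitSphere {u : EuclideanSpace ℝ (Fin n)} (hu : u ∈ unitSphere n) :
    u ≠ 0 :=
  ne_zero_of_mem_unit_sphere ⟨u, hu⟩

lemma inv_norm_smul_mem_unitSphere {v : EuclideanSpace ℝ (Fin n)} (hv : v ≠ 0) :
    ‖v‖⁻¹ • v ∈ unitSphere n :=
  mem_sphere_zero_iff_norm.2 (norm_smul_inv_norm (𝕜 := ℝ) hv)

lemma isCompact_unitSphere (n : ℕ) : IsCompact (unitSphere n) := isCompact_sphere 0 1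

lemma wulff_suppFn (hK : IsCompact K) (hconv : Convex ℝ K) (h0 : 0 ∈ K) :
    wulff (suppFn K) = K := by
  refine Set.Subset.antisymm (fun x hx => ?_) fun x hx u _ => inner_le_suppFn hK hx u
  by_contra hxK
  obtain ⟨f, s, hfs, hsx⟩ := geometric_hahn_banach_closed_point hconv hK.isClosed hxK
  obtain ⟨v, rfl⟩ := (InnerProductSpace.toDual ℝ (EuclideanSpace ℝ (Fin n))).surjective f
  simp only [InnerProductSpace.toDual_apply_apply] at hfs hsx
  have hs : 0 < s := by simpa using hfs 0 h0
  have hv : v ≠ 0 := by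
    rintro rfl
    rw [inner_zero_left] at hsx
    linarith
  have hv' : 0 < ‖v‖⁻¹ := inv_pos.2 (norm_pos_iff.2 hv)
  have hle : suppFn K (‖v‖⁻¹ • v) ≤ ‖v‖⁻¹ * s := by
    refine suppFn_le ⟨0, h0⟩ fun y hy => ?_
    rw [real_inner_smul_right, real_inner_comm]
    exact mul_le_mul_of_nonneg_left (hfs y hy).le hv'.le
  have hx' := (hx _ (inv_norm_smul_mem_unitSphere hv)).trans hle
  rw [real_inner_smul_right, real_inner_comm] at hx'
  exact hsx.not_ge (le_of_mul_le_mul_left hx' hv')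

lemma IsConvexBody.smul (hK : IsConvexBody K) {t : ℝ} (ht : t ≠ 0) : IsConvexBody (t • K) :=
  ⟨hK.1.smul t, hK.2.1.smul t, by rw [interior_smul₀ ht]; exact hK.2.2.smul_set⟩

variable {q : EuclideanSpace ℝ (Fin n) → ℝ}

lemma convex_wulff : Convex ℝ (wulff q) := by
  intro x hx y hy a b ha hb hab u hu
  rw [inner_add_left, real_inner_smul_left, real_inner_smul_left]
  calc a * ⟪x, u⟫_ℝ + b * ⟪y, u⟫_ℝ ≤ a * q u + b * q u := by
        gcongr
        exacts [hx u hu, hy u hu]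
    _ = q u := by rw [← add_mul, hab, one_mul]

lemma isClosed_wulff : IsClosed (wulff q) := by
  simp only [wulff, Set.ofPred_forall]
  exact isClosed_biInter fun u _ => isClosed_le (by fun_prop) continuous_const

lemma isCompact_wulff (hq : ContinuousOn q (unitSphere n)) : IsCompact (wulff q) := by
  refine Metric.isCompact_of_isClosed_isBounded isClosed_wulff ?_
  obtain ⟨M, hM⟩ := ((isCompact_unitSphere n).image_of_continuousOn hq).bddAbove
  refine isBounded_iff_forall_norm_le.2 ⟨max M 0, fun x hx => ?_⟩
  rcases eq_or_ne x 0 with rfl | hx0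
  · simp
  have hu := inv_norm_smul_mem_unitSphere hx0
  have h := (hx _ hu).trans (hM ⟨_, hu, rfl⟩)
  have hpos : 0 < ‖x‖ := norm_pos_iff.2 hx0
  rw [real_inner_smul_right, real_inner_self_eq_norm_sq, pow_two, ← mul_assoc,
    inv_mul_cancel₀ hpos.ne', one_mul] at h
  exact h.trans (le_max_left _ _)

lemma zero_mem_interior_wulff (hq : ContinuousOn q (unitSphere n))
    (hpos : ∀ u ∈ unitSphere n, 0 < q u) : 0 ∈ interior (wulff q) := by
  obtain ⟨m, hm, hmq⟩ : ∃ m > 0, ∀ u ∈ unitSphere n, m ≤ q u := by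
    rcases (unitSphere n).eq_empty_or_nonempty with h | h
    · exact ⟨1, one_pos, by simp [h]⟩
    · obtain ⟨u, hu, hmin⟩ := (isCompact_unitSphere n).exists_isMinOn h hq
      exact ⟨q u, hpos u hu, fun v hv => hmin hv⟩
  refine mem_interior_iff_mem_nhds.2 (Filter.mem_of_superset (Metric.ball_mem_nhds 0 hm) ?_)
  intro x hx u hu
  have hx' : ‖x‖ < m := mem_ball_zero_iff.1 hx
  have hu' : ‖u‖ = 1 := mem_sphere_zero_iff_norm.1 hu
  have h := real_inner_le_norm x u
  rw [hu', mul_one] at h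
  exact (h.trans hx'.le).trans (hmq u hu)

lemma isConvexBody_wulff (hq : ContinuousOn q (unitSphere n))
    (hpos : ∀ u ∈ unitSphere n, 0 < q u) : IsConvexBody (wulff q) :=
  ⟨isCompact_wulff hq, convex_wulff, 0, zero_mem_interior_wulff hq hpos⟩

lemma wulff_eq_neg (hq : ∀ u, q (-u) = q u) : wulff q = -wulff q := by
  have key : ∀ x ∈ wulff q, -x ∈ wulff q := by
    intro x hx u hu
    have h := hx (-u) (by simpa [unitSphere] using hu)
    rwa [inner_neg_right, hq, ← inner_neg_left] at h
  ext x
  exact ⟨key x, fun hx => by simpa using key _ hx⟩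

lemma suppFn_smul_wulff_le (hne : (wulff q).Nonempty) {t : ℝ} (ht : 0 ≤ t)
    {u : EuclideanSpace ℝ (Fin n)} (hu : u ∈ unitSphere n) :
    suppFn (t • wulff q) u ≤ t * q u := by
  refine suppFn_le hne.smul_set ?_
  rintro _ ⟨x, hx, rfl⟩
  rw [real_inner_smul_left]
  exact mul_le_mul_of_nonneg_left (hx u hu) ht

lemma integrable_log_of_continuous {ν : Measure (EuclideanSpace ℝ (Fin n))} [IsFiniteMeasure ν]
    (hν : ∀ᵐ u ∂ν, u ∈ unitSphere n) (hq : Continuous q)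
    (hpos : ∀ u ∈ unitSphere n, 0 < q u) : Integrable (fun u => Real.log (q u)) ν := by
  rw [← Measure.restrict_eq_self_of_ae_mem hν]
  exact (hq.continuousOn.log fun u hu => (hpos u hu).ne').integrableOn_compact
    (isCompact_unitSphere n)

lemma exp_logFunc_smul_wulff_le {ν : Measure (EuclideanSpace ℝ (Fin n))}
    [IsProbabilityMeasure ν] (hν : ∀ᵐ u ∂ν, u ∈ unitSphere n) (hq : Continuous q)
    (hpos : ∀ u ∈ unitSphere n, 0 < q u) (heven : ∀ u, q (-u) = q u) {t : ℝ} (ht : 0 < t) :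
    Real.exp (logFunc ν (t • wulff q)) ≤ t * Real.exp (∫ u, Real.log (q u) ∂ν) := by
  have hK := isConvexBody_wulff hq.continuousOn hpos
  have hQ := hK.smul ht.ne'
  have h0 : 0 ∈ interior (t • wulff q) :=
    zero_mem_interior_of_symmetric hQ (by rw [← Set.smul_set_neg, ← wulff_eq_neg heven])
  have hsupp : ∀ u ∈ unitSphere n, 0 < suppFn (t • wulff q) u := fun u hu =>
    suppFn_pos hQ.1 h0 (ne_zero_of_mem_unitSphere hu)
  have hint := integrable_log_of_continuous hν hq hpos
  have hmono : logFunc ν (t • wulff q) ≤ ∫ u, (Real.log t + Real.log (q u)) ∂ν := by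
    refine integral_mono_ae (integrable_log_of_continuous hν (continuous_suppFn hQ.1) hsupp)
      ((integrable_const _).add hint) ?_
    filter_upwards [hν] with u hu
    rw [← Real.log_mul ht.ne' (hpos u hu).ne']
    exact Real.log_le_log (hsupp u hu)
      (suppFn_smul_wulff_le (hK.2.2.mono interior_subset) ht.le hu)
  rw [integral_add (integrable_const _) hint, integral_const] at hmono
  calc Real.exp (logFunc ν (t • wulff q))
      ≤ Real.exp (Real.log t + ∫ u, Real.log (q u) ∂ν) := by
        simpa using hmono
    _ = t * Real.exp (∫ u, Real.log (q u) ∂ν) := by rw [Real.exp_add, Real.exp_log ht]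

end ConvexBodies

/-- the infimum of `Γ(q) = F([q])^{-1/α} exp(∫ log q dν)` over positive,
even, continuous functions `q` on the sphere equals the infimum of `exp(Φ_ν(Q))` over
origin-symmetric convex bodies `Q` with `F(Q) = 1`. -/
theorem gamma_inf_eq_inf_over_bodies (n : ℕ) (hn : 1 ≤ n)
    (ν : Measure (EuclideanSpace ℝ (Fin n))) [IsProbabilityMeasure ν]
    (hνsupp : ν (unitSphere n)ᶜ = 0)
    (hνeven : ν.map (fun x => -x) = ν)
    (α : ℝ) (hα : α ≠ 0)
    (F : Set (EuclideanSpace ℝ (Fin n)) → ℝ)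
    (hFpos : ∀ K, IsConvexBody K → 0 < F K)
    (hFcont : ∀ (K : ℕ → Set (EuclideanSpace ℝ (Fin n))) (L),
      (∀ i, IsConvexBody (K i)) → IsConvexBody L →
      Tendsto (fun i => Metric.hausdorffDist (K i) L) atTop (𝓝 0) →
      Tendsto (fun i => F (K i)) atTop (𝓝 (F L)))
    (hFhom : ∀ K, IsConvexBody K → ∀ t : ℝ, 0 < t → F (t • K) = t ^ α * F K) :
    sInf {r : ℝ | ∃ q : EuclideanSpace ℝ (Fin n) → ℝ, Continuous q ∧
        (∀ u ∈ unitSphere n, 0 < q u) ∧ (∀ u, q (-u) = q u) ∧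
        r = (F (wulff q)) ^ (-(1 / α)) * Real.exp (∫ u, Real.log (q u) ∂ν)}
      = sInf {r : ℝ | ∃ Q : Set (EuclideanSpace ℝ (Fin n)),
          IsConvexBody Q ∧ Q = -Q ∧ F Q = 1 ∧ r = Real.exp (logFunc ν Q)} := by
  have hν : ∀ᵐ u ∂ν, u ∈ unitSphere n := hνsupp
  set A := {r : ℝ | ∃ q : EuclideanSpace ℝ (Fin n) → ℝ, Continuous q ∧
        (∀ u ∈ unitSphere n, 0 < q u) ∧ (∀ u, q (-u) = q u) ∧
        r = (F (wulff q)) ^ (-(1 / α)) * Real.exp (∫ u, Real.log (q u) ∂ν)}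
  set B := {r : ℝ | ∃ Q : Set (EuclideanSpace ℝ (Fin n)),
          IsConvexBody Q ∧ Q = -Q ∧ F Q = 1 ∧ r = Real.exp (logFunc ν Q)}
  have hBA : B ⊆ A := by
    rintro _ ⟨Q, hQ, hsymm, hFQ, rfl⟩
    have h0 := zero_mem_interior_of_symmetric hQ hsymm
    refine ⟨suppFn Q, continuous_suppFn hQ.1,
      fun u hu => suppFn_pos hQ.1 h0 (ne_zero_of_mem_unitSphere hu), suppFn_neg hsymm, ?_⟩
    rw [wulff_suppFn hQ.1 hQ.2.1 (interior_subset h0), hFQ, Real.one_rpow, one_mul, logFunc]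
  have hAB : ∀ r ∈ A, ∃ s ∈ B, s ≤ r := by
    rintro _ ⟨q, hq, hpos, heven, rfl⟩
    have hK := isConvexBody_wulff hq.continuousOn hpos
    have hF := hFpos _ hK
    have ht : 0 < F (wulff q) ^ (-(1 / α)) := Real.rpow_pos_of_pos hF _
    refine ⟨_, ⟨F (wulff q) ^ (-(1 / α)) • wulff q, hK.smul ht.ne', ?_, ?_, rfl⟩,
      exp_logFunc_smul_wulff_le hν hq hpos heven ht⟩
    · rw [← Set.smul_set_neg, ← wulff_eq_neg heven]
    · rw [hFhom _ hK _ ht, ← Real.rpow_mul hF.le, neg_mul, one_div_mul_cancel hα,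
        Real.rpow_neg_one, inv_mul_cancel₀ hF.ne']
  have hAne : A.Nonempty :=
    ⟨_, fun _ => 1, continuous_const, fun _ _ => one_pos, fun _ => rfl, rfl⟩
  have hBne : B.Nonempty := by
    obtain ⟨r, hr⟩ := hAne
    obtain ⟨s, hs, -⟩ := hAB r hr
    exact ⟨s, hs⟩
  have hBbdd : BddBelow B := ⟨0, by rintro _ ⟨Q, -, -, -, rfl⟩; positivity⟩
  have hAbdd : BddBelow A := by
    refine ⟨0, fun r hr => ?_⟩
    obtain ⟨s, ⟨Q, -, -, -, rfl⟩, hsr⟩ := hAB r hr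
    exact (Real.exp_pos _).le.trans hsr
  refine le_antisymm (csInf_le_csInf hAbdd hBne hBA) (le_csInf hAne fun r hr => ?_)
  obtain ⟨s, hs, hsr⟩ := hAB r hr
  exact (csInf_le hBbdd hs).trans hsr
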